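/- Let W, M ∈ ℝ^{N×N} be symmetric matrices, M = U D Uᵀ where U ∈ ℝ^{N×d} has orthonormal columns and D ∈ ℝ^{d×d} is diagonal and invertible with positive diagonal entries, and let Û ∈ ℝ^{N×d} and diagonal D̂ ∈ ℝ^{d×d} with positive diagonal entries satisfy W Û = Û D̂. Set X̂ = Û D̂^{1/2}. Then for every orthogonal matrix S ∈ O(d), defining R_1 = U(UᵀÛD̂^{1/2} − D^{1/2}S), R_2 = (I − UUᵀ)(W − M)(Û − US)D̂^{−1/2}, R_3 = −UUᵀ(W − M)USD̂^{−1/2}, and R_4 = (W − M)U(SD̂^{−1/2} − D^{−1/2}S), the exact identity X̂ − UD^{1/2}S = (W − M)UD^{−1/2}S + R_1 + R_2 + R_3 + R_4 holds. -/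

import Mathlib

open Matrix

noncomputable section

/-- Entrywise square root of a diagonal matrix: `D^{1/2}`. -/
def diagSqrt {d : ℕ} (D : Matrix (Fin d) (Fin d) ℝ) : Matrix (Fin d) (Fin d) ℝ :=
  Matrix.of fun i j => if i = j then Real.sqrt (D i i) else 0

/-- Entrywise inverse square root of a diagonal matrix: `D^{−1/2}`. -/
def diagInvSqrt {d : ℕ} (D : Matrix (Fin d) (Fin d) ℝ) : Matrix (Fin d) (Fin d) ℝ :=
  Matrix.of fun i j => if i = j then (Real.sqrt (D i i))⁻¹ else 0

/-- For a diagonal matrix, `D * D^{−1/2} = D^{1/2}`. -/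
theorem mul_diagInvSqrt {d : ℕ} {D : Matrix (Fin d) (Fin d) ℝ} (hD : D.IsDiag) :
    D * diagInvSqrt D = diagSqrt D := by
  have hinv : diagInvSqrt D = diagonal fun i => (√(D i i))⁻¹ := by
    ext i j
    simp [diagInvSqrt, diagonal_apply]
  ext i j
  rw [hinv, mul_diagonal, diagSqrt, of_apply]
  split_ifs with h
  · subst h
    rw [← div_eq_mul_inv, Real.div_sqrt]
  · rw [hD h, zero_mul]

/-- The projection onto the orthogonal complement of the columns of `U` annihilates any
matrix that factors through `U`. -/
theorem one_sub_mul_transpose_mul_mul {N d n : ℕ} {U : Matrix (Fin N) (Fin d) ℝ}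
    (hU : Uᵀ * U = 1) (A : Matrix (Fin d) (Fin n) ℝ) : (1 - U * Uᵀ) * (U * A) = 0 := by
  rw [← Matrix.mul_assoc, Matrix.sub_mul, Matrix.mul_assoc U, hU, Matrix.one_mul,
    Matrix.mul_one, sub_self, Matrix.zero_mul]

/-- **The deterministic algebraic decomposition underlying the ASE consistency proof.**
With `X̂ = Û D̂^{1/2}`, for every orthogonal `S ∈ O(d)`:
`X̂ − U D^{1/2} S = (W − M) U D^{−1/2} S + R₁ + R₂ + R₃ + R₄`. -/
theorem ase_exact_decomposition {N d : ℕ}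
    (W M : Matrix (Fin N) (Fin N) ℝ) (hW : W.IsSymm) (hM : M.IsSymm)
    (U : Matrix (Fin N) (Fin d) ℝ) (D : Matrix (Fin d) (Fin d) ℝ)
    (hD : D.IsDiag) (hDpos : ∀ i, 0 < D i i) (hDinv : IsUnit D.det)
    (hMU : M = U * D * Uᵀ) (hU : Uᵀ * U = 1)
    (Uh : Matrix (Fin N) (Fin d) ℝ) (Dh : Matrix (Fin d) (Fin d) ℝ)
    (hDh : Dh.IsDiag) (hDhpos : ∀ i, 0 < Dh i i)
    (hWUh : W * Uh = Uh * Dh)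
    (S : Matrix (Fin d) (Fin d) ℝ) (hS1 : S * Sᵀ = 1) (hS2 : Sᵀ * S = 1) :
    Uh * diagSqrt Dh - U * diagSqrt D * S =
      (W - M) * U * diagInvSqrt D * S +
        U * (Uᵀ * Uh * diagSqrt Dh - diagSqrt D * S) +
        (1 - U * Uᵀ) * (W - M) * (Uh - U * S) * diagInvSqrt Dh +
        -(U * Uᵀ * (W - M) * U * S * diagInvSqrt Dh) +
        (W - M) * U * (S * diagInvSqrt Dh - diagInvSqrt D * S) := by
  have hproj : (1 - U * Uᵀ) * (W - M) * Uh * diagInvSqrt Dh =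
      (1 - U * Uᵀ) * (Uh * diagSqrt Dh) := by
    have hM0 : (1 - U * Uᵀ) * M = 0 := by
      rw [hMU, Matrix.mul_assoc, one_sub_mul_transpose_mul_mul hU]
    rw [Matrix.mul_sub, hM0, sub_zero, Matrix.mul_assoc (1 - U * Uᵀ), hWUh,
      Matrix.mul_assoc, Matrix.mul_assoc, mul_diagInvSqrt hDh]
  rw [Matrix.mul_sub _ Uh, Matrix.sub_mul _ _ (diagInvSqrt Dh), hproj]
  generalize W - M = E
  simp only [Matrix.mul_sub, Matrix.sub_mul, Matrix.one_mul, Matrix.mul_assoc]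
  abel
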